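/- arXiv:2501.04375 — 2 statements merged into one kernel-verified Lean document; each statement's English description precedes it below -/
import Mathlib

section
/- Let f ∈ 𝒦 have radius of convergence R > 0, with Khinchin family (X_t) and fulcrum F. Fix t = e^s with s < ln R. Then for every real θ with |θ| < π/2 the point s + iθ/σ_f(t) lies in the region where F is defined (f does not vanish at e^{s}e^{iθ/σ_f(t)}), and the characteristic function of the normalized variable satisfies E(e^{iθ X̆_t}) = exp( F(s + iθ/σ_f(t)) − F(s) − (F′(s)/F″(s)^{1/2})·iθ ). -/
open scoped BigOperators Topology
open Filter

namespace KhinchinPaper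

/-- Sum of the power series with coefficients `a` at `t`. -/
noncomputable def fsum (a : ℕ → ℝ) (t : ℝ) : ℝ := ∑' n : ℕ, a n * t ^ n

/-- The class `𝒦`: non-constant power series with non-negative coefficients, `a 0 > 0`,
and radius of convergence `R > 0`. -/
structure IsK (a : ℕ → ℝ) (R : ℝ) : Prop where
  pos₀ : 0 < a 0
  nonneg : ∀ n, 0 ≤ a n
  nonconst : ∃ n, 0 < n ∧ 0 < a n
  Rpos : 0 < R
  conv : ∀ t : ℝ, 0 ≤ t → t < R → Summable fun n : ℕ => a n * t ^ n
  radius : ∀ t : ℝ, R < t → ¬ Summable fun n : ℕ => a n * t ^ n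

/-- Mean function `m_f(t) = t f'(t)/f(t)`. -/
noncomputable def mf (a : ℕ → ℝ) (t : ℝ) : ℝ :=
  (∑' n : ℕ, (n : ℝ) * a n * t ^ n) / fsum a t

/-- Variance function `σ_f²(t)`. -/
noncomputable def sigma2 (a : ℕ → ℝ) (t : ℝ) : ℝ :=
  (∑' n : ℕ, (n : ℝ) ^ 2 * a n * t ^ n) / fsum a t - (mf a t) ^ 2

noncomputable def sigma (a : ℕ → ℝ) (t : ℝ) : ℝ := Real.sqrt (sigma2 a t)

/-- `k`-th moment of the normalized Khinchin family variable `X̆_t`. -/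
noncomputable def normMoment (a : ℕ → ℝ) (t : ℝ) (k : ℕ) : ℝ :=
  ∑' n : ℕ, (a n * t ^ n / fsum a t) * (((n : ℝ) - mf a t) / sigma a t) ^ k

/-- `k`-th central moment of `X_t`. -/
noncomputable def centralMoment (a : ℕ → ℝ) (t : ℝ) (k : ℕ) : ℝ :=
  ∑' n : ℕ, (a n * t ^ n / fsum a t) * ((n : ℝ) - mf a t) ^ k

/-- Characteristic function `E(e^{iθ X̆_t})` of the normalized variable. -/
noncomputable def charfun (a : ℕ → ℝ) (t θ : ℝ) : ℂ :=
  ∑' n : ℕ, ((a n * t ^ n / fsum a t : ℝ) : ℂ) *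
    Complex.exp (Complex.I * (θ : ℂ) * ((((n : ℝ) - mf a t) / sigma a t : ℝ) : ℂ))

/-- `f` is Gaussian: `X̆_t → N(0,1)` in distribution as `t ↑ R`, expressed via
pointwise convergence of characteristic functions (Lévy's continuity theorem). -/
def IsGaussian (a : ℕ → ℝ) (R : ℝ) : Prop :=
  ∀ θ : ℝ, Tendsto (fun t => charfun a t θ) (𝓝[<] R)
    (𝓝 (Complex.exp (-(θ : ℂ) ^ 2 / 2)))

/-- Gaussian for entire `f` (radius `R = ∞`, so `t → +∞`). -/
def IsGaussianEntire (a : ℕ → ℝ) : Prop :=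
  ∀ θ : ℝ, Tendsto (fun t => charfun a t θ) atTop
    (𝓝 (Complex.exp (-(θ : ℂ) ^ 2 / 2)))

/-- The fulcrum `F(s) = log f(e^s)` restricted to the real axis. -/
noncomputable def fulcrum (a : ℕ → ℝ) (s : ℝ) : ℝ := Real.log (fsum a (Real.exp s))

/-- The quotient `F^{(j)}(s) / F''(s)^{j/2}`. -/
noncomputable def Fq (a : ℕ → ℝ) (j : ℕ) (s : ℝ) : ℝ :=
  iteratedDeriv j (fulcrum a) s / (iteratedDeriv 2 (fulcrum a) s) ^ ((j : ℝ) / 2)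

/-- Tuples `(m₂, …, m_n)` of non-negative integers with `2m₂ + ⋯ + n m_n = n`,
padded with `m₀ = m₁ = 0` and encoded as functions on `Fin (n+1)`. -/
def tuples (n : ℕ) : Finset (Fin (n + 1) → ℕ) :=
  (Fintype.piFinset fun _ : Fin (n + 1) => Finset.range (n + 1)).filter
    fun m => m 0 = 0 ∧ m 1 = 0 ∧ ∑ j : Fin (n + 1), (j : ℕ) * m j = n

/-- Integer moments of a standard normal random variable `Z`. -/
noncomputable def gaussMoment (k : ℕ) : ℝ :=
  if Even k then (Nat.factorial k : ℝ) / ((Nat.factorial (k / 2) : ℝ) * 2 ^ (k / 2)) else 0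

/-- The complex power series sum. -/
noncomputable def fsumC (a : ℕ → ℝ) (z : ℂ) : ℂ := ∑' n : ℕ, (a n : ℂ) * z ^ n

/-- The complex fulcrum `F(z) = log f(e^z)`. -/
noncomputable def fulcrumC (a : ℕ → ℝ) (z : ℂ) : ℂ := Complex.log (fsumC a (Complex.exp z))

end KhinchinPaper

namespace KhinchinPaper

lemma summable_natCast_mul {b : ℕ → ℝ} {R : ℝ} (hb : ∀ n, 0 ≤ b n)
    (h : ∀ s, Real.exp s < R → Summable fun n : ℕ => b n * Real.exp s ^ n)
    (s : ℝ) (hs : Real.exp s < R) : Summable fun n : ℕ => (n : ℝ) * b n * Real.exp s ^ n := by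
  have hR : 0 < R := (Real.exp_pos s).trans hs
  obtain ⟨r, hsr, hrR⟩ := exists_between ((Real.lt_log_iff_exp_lt hR).2 hs)
  refine Summable.of_nonneg_of_le (fun n => ?_) (fun n => ?_)
    ((h r ((Real.lt_log_iff_exp_lt hR).1 hrR)).mul_left (r - s)⁻¹)
  · have := hb n
    positivity
  · have hδ : 0 < r - s := sub_pos.2 hsr
    have hexp : (n : ℝ) * (r - s) ≤ Real.exp (n * (r - s)) := by
      linarith [Real.add_one_le_exp ((n : ℝ) * (r - s))]
    have hmul : Real.exp r ^ n = Real.exp (n * (r - s)) * Real.exp s ^ n := by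
      rw [← Real.exp_nat_mul, ← Real.exp_nat_mul, ← Real.exp_add]
      ring_nf
    rw [inv_mul_eq_div, le_div_iff₀ hδ, hmul]
    have := mul_le_mul_of_nonneg_right hexp
      (mul_nonneg (hb n) (pow_nonneg (Real.exp_pos s).le n))
    linarith

/-- A power series with non-negative coefficients can be differentiated termwise inside its
interval of convergence. -/
lemma hasDerivAt_tsum_mul_exp_pow {b : ℕ → ℝ} {R : ℝ} (hb : ∀ n, 0 ≤ b n)
    (h : ∀ s, Real.exp s < R → Summable fun n : ℕ => b n * Real.exp s ^ n)
    (s : ℝ) (hs : Real.exp s < R) :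
    HasDerivAt (fun x => ∑' n : ℕ, b n * Real.exp x ^ n)
      (∑' n : ℕ, (n : ℝ) * b n * Real.exp s ^ n) s := by
  have hR : 0 < R := (Real.exp_pos s).trans hs
  obtain ⟨r, hsr, hrR⟩ := exists_between ((Real.lt_log_iff_exp_lt hR).2 hs)
  refine hasDerivAt_tsum_of_isPreconnected (t := Set.Iio r)
    (g' := fun (n : ℕ) x => (n : ℝ) * b n * Real.exp x ^ n)
    (summable_natCast_mul hb h r ((Real.lt_log_iff_exp_lt hR).1 hrR)) isOpen_Iio
    isPreconnected_Iio (fun n x _ => ?_) (fun n x hx => ?_) hsr (h s hs) hsr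
  · simp_rw [← Real.exp_nat_mul]
    exact ((((hasDerivAt_id' x).const_mul (n : ℝ)).exp).const_mul (b n)).congr_deriv (by ring)
  · have := hb n
    rw [Real.norm_of_nonneg (by positivity)]
    gcongr
    exact (Set.mem_Iio.1 hx).le

lemma IsK.summable_exp {a : ℕ → ℝ} {R : ℝ} (hK : IsK a R) (s : ℝ) (hs : Real.exp s < R) :
    Summable fun n : ℕ => a n * Real.exp s ^ n :=
  hK.conv _ (Real.exp_pos s).le hs

lemma IsK.summable_natCast_mul {a : ℕ → ℝ} {R : ℝ} (hK : IsK a R) (s : ℝ)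
    (hs : Real.exp s < R) : Summable fun n : ℕ => (n : ℝ) * a n * Real.exp s ^ n :=
  KhinchinPaper.summable_natCast_mul hK.nonneg hK.summable_exp s hs

lemma IsK.summable_natCast_sq_mul {a : ℕ → ℝ} {R : ℝ} (hK : IsK a R) (s : ℝ)
    (hs : Real.exp s < R) : Summable fun n : ℕ => (n : ℝ) ^ 2 * a n * Real.exp s ^ n := by
  simpa only [sq, mul_assoc] using KhinchinPaper.summable_natCast_mul
    (fun n => mul_nonneg (Nat.cast_nonneg n) (hK.nonneg n)) hK.summable_natCast_mul s hs

lemma IsK.fsum_pos {a : ℕ → ℝ} {R : ℝ} (hK : IsK a R) (s : ℝ) (hs : Real.exp s < R) :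
    0 < fsum a (Real.exp s) :=
  (hK.summable_exp s hs).tsum_pos
    (fun n => mul_nonneg (hK.nonneg n) (pow_nonneg (Real.exp_pos s).le n)) 0
    (by simpa using hK.pos₀)

lemma IsK.hasDerivAt_fulcrum {a : ℕ → ℝ} {R : ℝ} (hK : IsK a R) (s : ℝ)
    (hs : Real.exp s < R) : HasDerivAt (fulcrum a) (mf a (Real.exp s)) s :=
  (hasDerivAt_tsum_mul_exp_pow hK.nonneg hK.summable_exp s hs).log (hK.fsum_pos s hs).ne'

lemma IsK.hasDerivAt_mf_exp {a : ℕ → ℝ} {R : ℝ} (hK : IsK a R) (s : ℝ)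
    (hs : Real.exp s < R) :
    HasDerivAt (fun x => mf a (Real.exp x)) (sigma2 a (Real.exp s)) s := by
  have h0 := hasDerivAt_tsum_mul_exp_pow hK.nonneg hK.summable_exp s hs
  have h1 := hasDerivAt_tsum_mul_exp_pow
    (fun n => mul_nonneg (Nat.cast_nonneg n) (hK.nonneg n)) hK.summable_natCast_mul s hs
  have hne : (∑' n : ℕ, a n * Real.exp s ^ n) ≠ 0 := (hK.fsum_pos s hs).ne'
  refine (h1.div h0 hne).congr_deriv ?_
  simp only [sigma2, mf, fsum, ← mul_assoc, ← sq]
  field_simp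

lemma IsK.iteratedDeriv_two_fulcrum {a : ℕ → ℝ} {R : ℝ} (hK : IsK a R) (s : ℝ)
    (hs : Real.exp s < R) : iteratedDeriv 2 (fulcrum a) s = sigma2 a (Real.exp s) := by
  have hev : deriv (fulcrum a) =ᶠ[𝓝 s] fun x => mf a (Real.exp x) := by
    filter_upwards [Real.continuous_exp.continuousAt.eventually_lt continuousAt_const hs]
      with x hx using (hK.hasDerivAt_fulcrum x hx).deriv
  rw [iteratedDeriv_succ, iteratedDeriv_one, hev.deriv_eq]
  exact (hK.hasDerivAt_mf_exp s hs).deriv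

lemma pi_div_four_sub_sq_div_pi_le_cos (x : ℝ) : Real.pi / 4 - x ^ 2 / Real.pi ≤ Real.cos x := by
  have hpi := Real.pi_pos
  wlog hx : 0 ≤ x generalizing x
  · simpa using this (-x) (by linarith)
  set y := Real.pi / 2 - x with hy
  have hx' : x = Real.pi / 2 - y := by rw [hy]; ring
  have hlhs : Real.pi / 4 - x ^ 2 / Real.pi = y - y ^ 2 / Real.pi := by
    rw [hx']; field_simp; ring
  rw [hlhs, hx', Real.cos_pi_div_two_sub]
  rcases le_total y 0 with h0 | h0
  · have h1 : y ≤ Real.sin y := by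
      have := Real.sin_le (x := -y) (by linarith)
      rw [Real.sin_neg] at this
      linarith
    have h2 : 0 ≤ y ^ 2 / Real.pi := by positivity
    linarith
  · have hd : ∀ z, HasDerivAt (fun z => Real.sin z - z + z ^ 2 / Real.pi)
        (Real.cos z - 1 + 2 * z / Real.pi) z := fun z => by
      simpa using ((Real.hasDerivAt_sin z).fun_sub (hasDerivAt_id' z)).fun_add
        ((hasDerivAt_pow 2 z).div_const Real.pi)
    have hmono : MonotoneOn (fun z => Real.sin z - z + z ^ 2 / Real.pi)
        (Set.Icc 0 (Real.pi / 2)) := by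
      refine monotoneOn_of_deriv_nonneg (convex_Icc _ _)
        (fun z _ => (hd z).continuousAt.continuousWithinAt)
        (fun z _ => (hd z).differentiableAt.differentiableWithinAt) fun z hz => ?_
      rw [interior_Icc] at hz
      rw [(hd z).deriv]
      have := Real.one_sub_mul_le_cos hz.1.le hz.2.le
      have h3 : 2 / Real.pi * z = 2 * z / Real.pi := by ring
      linarith
    have := hmono ⟨le_rfl, by positivity⟩ ⟨h0, by linarith⟩ h0
    simp only [Real.sin_zero] at this
    norm_num at this
    linarith

lemma IsK.tsum_mul_cos_pos {a : ℕ → ℝ} {R : ℝ} (hK : IsK a R) (s : ℝ) (hs : Real.exp s < R)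
    (φ : ℝ) (hφ : φ ^ 2 * sigma2 a (Real.exp s) < (Real.pi / 2) ^ 2) :
    0 < ∑' n : ℕ, a n * Real.exp s ^ n * Real.cos (φ * (n - mf a (Real.exp s))) := by
  have hpi := Real.pi_pos
  have hpos := hK.fsum_pos s hs
  set m := mf a (Real.exp s) with hm
  have h0 := (hK.summable_exp s hs).hasSum
  have h1 := (hK.summable_natCast_mul s hs).hasSum
  have h2 := (hK.summable_natCast_sq_mul s hs).hasSum
  have hquad := ((h0.mul_left (Real.pi / 4 - φ ^ 2 * m ^ 2 / Real.pi)).add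
    (h1.mul_left (2 * m * φ ^ 2 / Real.pi))).sub (h2.mul_left (φ ^ 2 / Real.pi))
  have hcos : Summable fun n : ℕ => a n * Real.exp s ^ n * Real.cos (φ * (n - m)) := by
    refine (hK.summable_exp s hs).of_norm_bounded fun n => ?_
    have := mul_nonneg (hK.nonneg n) (pow_nonneg (Real.exp_pos s).le n)
    rw [norm_mul, Real.norm_of_nonneg this]
    exact mul_le_of_le_one_right this (Real.abs_cos_le_one _)
  refine lt_of_lt_of_le ?_ (hasSum_le (fun n => ?_) hquad hcos.hasSum)
  · have e1 : (∑' n : ℕ, (n : ℝ) * a n * Real.exp s ^ n) = m * fsum a (Real.exp s) := by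
      rw [hm, mf, div_mul_cancel₀ _ hpos.ne']
    have e2 : (∑' n : ℕ, (n : ℝ) ^ 2 * a n * Real.exp s ^ n) =
        (sigma2 a (Real.exp s) + m ^ 2) * fsum a (Real.exp s) := by
      rw [hm, sigma2, sub_add_cancel, div_mul_cancel₀ _ hpos.ne']
    rw [e1, e2, ← fsum]
    have : 0 < fsum a (Real.exp s) / Real.pi *
        ((Real.pi / 2) ^ 2 - φ ^ 2 * sigma2 a (Real.exp s)) :=
      mul_pos (by positivity) (by linarith)
    refine this.trans_eq ?_
    field_simp
    ring
  · have := mul_le_mul_of_nonneg_left (pi_div_four_sub_sq_div_pi_le_cos (φ * (n - m)))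
      (mul_nonneg (hK.nonneg n) (pow_nonneg (Real.exp_pos s).le n))
    exact (by ring : _ = _).trans_le this

/-- The zero-free region of `f`. -/
lemma IsK.fsumC_ne_zero {a : ℕ → ℝ} {R : ℝ} (hK : IsK a R) (s : ℝ) (hs : Real.exp s < R)
    (φ : ℝ) (hφ : φ ^ 2 * sigma2 a (Real.exp s) < (Real.pi / 2) ^ 2) :
    fsumC a (Complex.exp (s + Complex.I * φ)) ≠ 0 := by
  intro hzero
  have hsum : Summable fun n : ℕ => (a n : ℂ) * Complex.exp (s + Complex.I * φ) ^ n := by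
    refine (hK.summable_exp s hs).of_norm_bounded fun n => ?_
    simp [Complex.norm_exp, abs_of_nonneg (hK.nonneg n)]
  have h := Complex.hasSum_re
    (hsum.hasSum.mul_right (Complex.exp (-(Complex.I * φ * mf a (Real.exp s)))))
  rw [← fsumC, hzero, zero_mul, Complex.zero_re] at h
  refine (hK.tsum_mul_cos_pos s hs φ hφ).ne' (Eq.trans (tsum_congr fun n => ?_) h.tsum_eq)
  have : (a n : ℂ) * Complex.exp (s + Complex.I * φ) ^ n *
      Complex.exp (-(Complex.I * φ * mf a (Real.exp s))) =
      ((a n * Real.exp s ^ n : ℝ) : ℂ) *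
        Complex.exp ((φ * (n - mf a (Real.exp s)) : ℝ) * Complex.I) := by
    push_cast
    simp only [← Complex.exp_nat_mul, mul_assoc, ← Complex.exp_add]
    ring_nf
  rw [this, Complex.re_ofReal_mul, Complex.exp_ofReal_mul_I_re]

lemma fsumC_ofReal (a : ℕ → ℝ) (t : ℝ) : fsumC a t = fsum a t := by
  simp [fsumC, fsum, Complex.ofReal_tsum]

lemma charfun_exp (a : ℕ → ℝ) (s θ : ℝ) :
    charfun a (Real.exp s) θ =
      fsumC a (Complex.exp (s + Complex.I * θ / (sigma a (Real.exp s) : ℝ))) /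
        fsum a (Real.exp s) *
        Complex.exp (-((mf a (Real.exp s) / sigma a (Real.exp s) : ℝ) * Complex.I * θ)) := by
  rw [charfun, fsumC, ← tsum_div_const, ← tsum_mul_right]
  refine tsum_congr fun n => ?_
  push_cast
  simp only [← Complex.exp_nat_mul, mul_div_right_comm _ (Complex.exp _), mul_assoc,
    ← Complex.exp_add]
  ring_nf

/-- for `t = e^s` with `s < ln R` and `|θ| < π/2`, the point
`s + iθ/σ_f(t)` lies in the zero-free region of `f`, and
`E(e^{iθ X̆_t}) = exp(F(s+iθ/σ_f(t)) − F(s) − (F'(s)/F''(s)^{1/2}) iθ)`. -/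
theorem statement0 (a : ℕ → ℝ) (R : ℝ) (hK : IsK a R) (s : ℝ) (hs : Real.exp s < R)
    (θ : ℝ) (hθ : |θ| < Real.pi / 2) :
    fsumC a (Complex.exp ((s : ℂ) + Complex.I * (θ : ℂ) / ((sigma a (Real.exp s) : ℝ) : ℂ))) ≠ 0 ∧
    charfun a (Real.exp s) θ =
      Complex.exp (fulcrumC a ((s : ℂ) + Complex.I * (θ : ℂ) / ((sigma a (Real.exp s) : ℝ) : ℂ))
        - fulcrumC a (s : ℂ)
        - ((deriv (fulcrum a) s / Real.sqrt (iteratedDeriv 2 (fulcrum a) s) : ℝ) : ℂ)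
            * Complex.I * (θ : ℂ)) := by
  have hφ : (θ / sigma a (Real.exp s)) ^ 2 * sigma2 a (Real.exp s) < (Real.pi / 2) ^ 2 := by
    have hθ2 : θ ^ 2 < (Real.pi / 2) ^ 2 := sq_lt_sq' (abs_lt.1 hθ).1 (abs_lt.1 hθ).2
    rcases le_or_gt (sigma2 a (Real.exp s)) 0 with h | h
    · simp only [sigma, Real.sqrt_eq_zero_of_nonpos h, div_zero]
      have := Real.pi_pos
      simp only [ne_eq, OfNat.ofNat_ne_zero, not_false_eq_true, zero_pow, zero_mul]
      positivity
    · rwa [div_pow, sigma, Real.sq_sqrt h.le, div_mul_cancel₀ _ h.ne']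
  have hne := hK.fsumC_ne_zero s hs _ hφ
  rw [Complex.ofReal_div, ← mul_div_assoc] at hne
  refine ⟨hne, ?_⟩
  have hpos : (fsum a (Real.exp s) : ℂ) ≠ 0 := by exact_mod_cast (hK.fsum_pos s hs).ne'
  rw [charfun_exp, (hK.hasDerivAt_fulcrum s hs).deriv, hK.iteratedDeriv_two_fulcrum s hs,
    ← sigma, sub_eq_add_neg (_ - _), Complex.exp_add (_ - _), Complex.exp_sub, fulcrumC, fulcrumC,
    Complex.exp_log hne, ← Complex.ofReal_exp, fsumC_ofReal, Complex.exp_log hpos]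

end KhinchinPaper
end

section
/- Let f ∈ 𝒦 have radius of convergence R > 0, Khinchin family (X_t) and fulcrum F. Fix t = e^s ∈ (0,R) and an even integer n = 2k with k ≥ 2. Then E(X̆_t^n) − (2k)!/(k!·2^k) = Σ_{(m₂,…,m_n), m₂ ≠ k} n!/(m₂!⋯m_n!) · ∏_{j=2}^{n} ( F^{(j)}(s)/(F″(s)^{j/2} · j!) )^{m_j}, where the sum runs over all tuples of non-negative integers (m₂,…,m_n) with 2m₂ + 3m₃ + ⋯ + n·m_n = n and m₂ ≠ k. -/
open scoped BigOperators Topology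
open Filter

namespace KhinchinPaper

open MeasureTheory ProbabilityTheory

/-- Functions `m` on `Fin (N + 1)` with `m 0 = m 1 = 0` and `∑ j, j * m j = n`. -/
def weightedTuples (N n : ℕ) : Finset (Fin (N + 1) → ℕ) :=
  (Fintype.piFinset fun _ : Fin (N + 1) => Finset.range (N + 1)).filter
    fun m => m 0 = 0 ∧ m 1 = 0 ∧ ∑ j : Fin (N + 1), (j : ℕ) * m j = n

lemma mem_weightedTuples {N n : ℕ} (hn : n ≤ N) {m : Fin (N + 1) → ℕ} :
    m ∈ weightedTuples N n ↔
      m 0 = 0 ∧ m 1 = 0 ∧ ∑ j : Fin (N + 1), (j : ℕ) * m j = n := by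
  simp only [weightedTuples, Finset.mem_filter, Fintype.mem_piFinset, Finset.mem_range,
    and_iff_right_iff_imp]
  rintro ⟨h0, -, hsum⟩ j
  rcases eq_or_ne j 0 with rfl | hj
  · simp [h0]
  · have hle : (j : ℕ) * m j ≤ n := by
      rw [← hsum]
      exact Finset.single_le_sum (f := fun j : Fin (N + 1) => (j : ℕ) * m j)
        (fun _ _ => Nat.zero_le _) (Finset.mem_univ j)
    have hj' : 0 < (j : ℕ) := Fin.pos_iff_ne_zero.mpr hj
    nlinarith [Nat.le_mul_of_pos_left (m j) hj']

/-- The coefficient of `z ^ n` in `exp (∑ 2 ≤ j ≤ N, x j * z ^ j)`, as a sum over tuples. -/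
noncomputable def tupleSum (x : ℕ → ℝ) (N n : ℕ) : ℝ :=
  ∑ m ∈ weightedTuples N n, ∏ j : Fin (N + 1), x j ^ m j / (m j).factorial

lemma tupleSum_zero (x : ℕ → ℝ) (N : ℕ) : tupleSum x N 0 = 1 := by
  have h : weightedTuples N 0 = {0} := by
    ext m
    rw [mem_weightedTuples (Nat.zero_le N), Finset.mem_singleton]
    constructor
    · rintro ⟨h0, -, hsum⟩
      funext j
      rcases eq_or_ne j 0 with rfl | hj
      · exact h0
      · have := (Finset.sum_eq_zero_iff.mp hsum) j (Finset.mem_univ j)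
        rcases Nat.mul_eq_zero.mp this with h | h
        · exact absurd (Fin.ext h) hj
        · exact h
    · rintro rfl
      simp
  simp [tupleSum, h]

lemma sum_mul_add_single {N : ℕ} (m : Fin (N + 1) → ℕ) (i : Fin (N + 1)) :
    ∑ j : Fin (N + 1), (j : ℕ) * (m + Pi.single i 1 : Fin (N + 1) → ℕ) j =
      ∑ j : Fin (N + 1), (j : ℕ) * m j + i := by
  simp [mul_add, Finset.sum_add_distrib, Pi.single_apply]

lemma prod_add_single (x : ℕ → ℝ) {N : ℕ} (m : Fin (N + 1) → ℕ) (i : Fin (N + 1)) :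
    ((m + Pi.single i 1 : Fin (N + 1) → ℕ) i : ℝ) *
        ∏ j : Fin (N + 1), x j ^ (m + Pi.single i 1 : Fin (N + 1) → ℕ) j / ((m + Pi.single i 1 : Fin (N + 1) → ℕ) j).factorial =
      x i * ∏ j : Fin (N + 1), x j ^ m j / (m j).factorial := by
  rw [← Finset.mul_prod_erase _ _ (Finset.mem_univ i),
    ← Finset.mul_prod_erase _ (fun j : Fin (N + 1) => x j ^ m j / ((m j).factorial : ℝ))
      (Finset.mem_univ i)]
  have h : ∏ j ∈ Finset.univ.erase i,
        x j ^ (m + Pi.single i 1 : Fin (N + 1) → ℕ) j / (((m + Pi.single i 1 : Fin (N + 1) → ℕ) j).factorial : ℝ) =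
      ∏ j ∈ Finset.univ.erase i, x j ^ m j / ((m j).factorial : ℝ) :=
    Finset.prod_congr rfl fun j hj => by simp [Finset.ne_of_mem_erase hj]
  rw [h]
  have h1 : (m + Pi.single i 1 : Fin (N + 1) → ℕ) i = m i + 1 := by simp
  rw [h1, Nat.factorial_succ, pow_succ]
  push_cast
  have h2 : ((m i).factorial : ℝ) ≠ 0 := by positivity
  have h3 : (m i : ℝ) + 1 ≠ 0 := by positivity
  field_simp

lemma sum_apply_mul_prod (x : ℕ → ℝ) {N n : ℕ} (hn : n ≤ N) (i : Fin (N + 1))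
    (hi : 2 ≤ (i : ℕ)) :
    ∑ m ∈ weightedTuples N n, (m i : ℝ) * ∏ j : Fin (N + 1), x j ^ m j / (m j).factorial =
      if (i : ℕ) ≤ n then x i * tupleSum x N (n - i) else 0 := by
  have hi0 : (0 : Fin (N + 1)) ≠ i := by
    rintro rfl
    simp at hi
  have hi1 : (1 : Fin (N + 1)) ≠ i := by
    rintro rfl
    have := Nat.mod_le 1 (N + 1)
    rw [Fin.val_one'] at hi
    omega
  have hrestrict : ∑ m ∈ weightedTuples N n,
        (m i : ℝ) * ∏ j : Fin (N + 1), x j ^ m j / (m j).factorial =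
      ∑ m ∈ (weightedTuples N n).filter (fun m => m i ≠ 0),
        (m i : ℝ) * ∏ j : Fin (N + 1), x j ^ m j / (m j).factorial := by
    refine (Finset.sum_filter_of_ne (p := fun m : Fin (N + 1) → ℕ => m i ≠ 0)
      fun m _ h hmi => h ?_).symm
    simp [hmi]
  rw [hrestrict]
  split_ifs with hin
  · rw [tupleSum, Finset.mul_sum]
    symm
    refine Finset.sum_bij' (fun m _ => m + Pi.single i 1) (fun m _ => m - Pi.single i 1)
      ?_ ?_ ?_ ?_ ?_
    · intro m hm
      rw [mem_weightedTuples (by omega)] at hm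
      rw [Finset.mem_filter, mem_weightedTuples hn, sum_mul_add_single, hm.2.2]
      simp [hi0, hi1, hm.1, hm.2.1, hin]
    · intro m hm
      rw [Finset.mem_filter, mem_weightedTuples hn] at hm
      have hadd : m - Pi.single i 1 + Pi.single i 1 = m := by
        funext j
        rcases eq_or_ne j i with rfl | hj
        · simp only [Pi.add_apply, Pi.sub_apply, Pi.single_eq_same]
          omega
        · simp [hj]
      have hsum := sum_mul_add_single (m - Pi.single i 1) i
      rw [hadd, hm.1.2.2] at hsum
      rw [mem_weightedTuples (by omega)]
      refine ⟨by simp [hm.1.1], by simp [hm.1.2.1], by omega⟩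
    · intro m _
      simp
    · intro m hm
      rw [Finset.mem_filter] at hm
      funext j
      rcases eq_or_ne j i with rfl | hj
      · have := hm.2
        simp only [Pi.add_apply, Pi.sub_apply, Pi.single_eq_same]
        omega
      · simp [hj]
    · intro m _
      exact (prod_add_single x m i).symm
  · refine Finset.sum_eq_zero fun m hm => absurd ?_ hin
    rw [Finset.mem_filter, mem_weightedTuples hn] at hm
    have := Finset.single_le_sum (f := fun j : Fin (N + 1) => (j : ℕ) * m j)
      (fun _ _ => Nat.zero_le _) (Finset.mem_univ i)
    rw [hm.1.2.2] at this
    exact (Nat.le_mul_of_pos_right _ (Nat.pos_of_ne_zero hm.2)).trans this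

lemma nat_mul_tupleSum (x : ℕ → ℝ) (hx : x 1 = 0) {N n : ℕ} (hn : n ≤ N) :
    n * tupleSum x N n = ∑ j ∈ Finset.range (n + 1), j * x j * tupleSum x N (n - j) := by
  have hswap : n * tupleSum x N n = ∑ i : Fin (N + 1), (i : ℝ) *
      ∑ m ∈ weightedTuples N n, (m i : ℝ) * ∏ j : Fin (N + 1), x j ^ m j / (m j).factorial := by
    simp_rw [Finset.mul_sum]
    rw [Finset.sum_comm, tupleSum, Finset.mul_sum]
    refine Finset.sum_congr rfl fun m hm => ?_
    rw [mem_weightedTuples hn] at hm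
    simp_rw [← mul_assoc]
    rw [← Finset.sum_mul]
    congr 1
    exact_mod_cast hm.2.2.symm
  have hterm : ∀ i : Fin (N + 1), (i : ℝ) *
      ∑ m ∈ weightedTuples N n, (m i : ℝ) * ∏ j : Fin (N + 1), x j ^ m j / (m j).factorial =
      (fun i : ℕ => if i ≤ n then (i : ℝ) * x i * tupleSum x N (n - i) else 0) i := by
    intro i
    rcases Nat.lt_or_ge (i : ℕ) 2 with hi | hi
    · interval_cases h : (i : ℕ)
      · simp
      · have hi1 : i = 1 := by
          ext
          have hlt := i.isLt
          rw [h, Fin.val_one', Nat.mod_eq_of_lt (by omega)]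
        have hzero : ∑ m ∈ weightedTuples N n,
            (m i : ℝ) * ∏ j : Fin (N + 1), x j ^ m j / (m j).factorial = 0 := by
          refine Finset.sum_eq_zero fun m hm => ?_
          rw [mem_weightedTuples hn] at hm
          simp [hi1, hm.2.1]
        rw [hzero]
        simp [hx]
    · rw [sum_apply_mul_prod x hn i hi]
      simp only [mul_ite, mul_zero, mul_assoc]
  rw [hswap, Finset.sum_congr rfl fun i _ => hterm i,
    Fin.sum_univ_eq_sum_range
      (fun i : ℕ => if i ≤ n then (i : ℝ) * x i * tupleSum x N (n - i) else 0) (N + 1),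
    ← Finset.sum_filter]
  refine Finset.sum_congr ?_ fun _ _ => rfl
  ext i
  simp only [Finset.mem_filter, Finset.mem_range]
  omega

lemma eq_tupleSum_of_recurrence (x b : ℕ → ℝ) (hx : x 1 = 0) (hb0 : b 0 = 1)
    (hb : ∀ n, n * b n = ∑ j ∈ Finset.range (n + 1), j * x j * b (n - j))
    {N n : ℕ} (hn : n ≤ N) : b n = tupleSum x N n := by
  induction n using Nat.strong_induction_on with
  | _ n ih =>
    rcases Nat.eq_zero_or_pos n with rfl | hpos
    · rw [hb0, tupleSum_zero]
    · have hne : (n : ℝ) ≠ 0 := by positivity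
      refine mul_left_cancel₀ hne ?_
      rw [hb, nat_mul_tupleSum x hx hn]
      refine Finset.sum_congr rfl fun j _ => ?_
      rcases Nat.eq_zero_or_pos j with rfl | hj
      · simp
      · rw [ih (n - j) (by omega) (by omega)]

/-- The recurrence between the derivatives of `exp ∘ K` and those of `K`. -/
lemma iteratedDeriv_succ_of_eventuallyEq_exp {G K : ℝ → ℝ} {s : ℝ} (hG : AnalyticAt ℝ G s)
    (hK : AnalyticAt ℝ K s) (h : G =ᶠ[𝓝 s] fun u => Real.exp (K u)) (n : ℕ) :
    iteratedDeriv (n + 1) G s = ∑ i ∈ Finset.range (n + 1),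
      (n.choose i : ℝ) * iteratedDeriv i G s * iteratedDeriv (n - i + 1) K s := by
  have hderiv : deriv G =ᶠ[𝓝 s] G * deriv K := by
    filter_upwards [h.eventuallyEq_nhds, hK.eventually_analyticAt] with u hu hKu
    rw [hu.deriv_eq, Pi.mul_apply, hu.eq_of_nhds]
    exact hKu.differentiableAt.hasDerivAt.exp.deriv
  rw [iteratedDeriv_succ', hderiv.iteratedDeriv_eq,
    iteratedDeriv_mul hG.contDiffAt hK.deriv.contDiffAt]
  simp_rw [iteratedDeriv_succ']

/-- The moment-cumulant recurrence, for coefficients of exponential generating functions scaled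
by powers of `v`. -/
lemma nat_mul_scaled_iteratedDeriv {G K : ℝ → ℝ} {s : ℝ} (hG : AnalyticAt ℝ G s)
    (hK : AnalyticAt ℝ K s) (h : G =ᶠ[𝓝 s] fun u => Real.exp (K u)) {v : ℝ} (hv : v ≠ 0)
    (c : ℝ) (n : ℕ) :
    n * (c * iteratedDeriv n G s / (v ^ n * n.factorial)) =
      ∑ j ∈ Finset.range (n + 1), j * (iteratedDeriv j K s / (v ^ j * j.factorial)) *
        (c * iteratedDeriv (n - j) G s / (v ^ (n - j) * (n - j).factorial)) := by
  cases n with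
  | zero => simp
  | succ n =>
    rw [Finset.sum_range_succ', iteratedDeriv_succ_of_eventuallyEq_exp hG hK h n,
      ← Finset.sum_range_reflect, Finset.mul_sum, Finset.sum_div, Finset.mul_sum]
    simp only [Nat.cast_zero, zero_mul, add_zero]
    refine Finset.sum_congr rfl fun i hi => ?_
    obtain ⟨d, rfl⟩ := Nat.exists_eq_add_of_le (Nat.lt_succ_iff.mp (Finset.mem_range.mp hi))
    have e1 : i + d + 1 - 1 - i = d := by omega
    have e2 : i + d - d = i := by omega
    have e3 : i + d + 1 - (i + 1) = d := by omega
    rw [e1, e2, e3, Nat.add_comm i d, Nat.cast_add_choose ℝ]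
    rw [Nat.factorial_succ (d + i), Nat.factorial_succ i]
    push_cast
    have h1 : ((d + i).factorial : ℝ) ≠ 0 := by positivity
    have h2 : (d.factorial : ℝ) ≠ 0 := by positivity
    have h3 : (i.factorial : ℝ) ≠ 0 := by positivity
    have h4 : (d : ℝ) + i + 1 ≠ 0 := by positivity
    have h5 : (i : ℝ) + 1 ≠ 0 := by positivity
    field_simp
    ring

lemma weightedTuples_self (n : ℕ) : weightedTuples n n = tuples n := rfl

lemma filter_weightedTuples_eq_singleton {k : ℕ} (hk : 1 ≤ k) :
    (weightedTuples (2 * k) (2 * k)).filter (fun m => m 2 = k) = {Pi.single 2 k} := by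
  have hval : ((2 : Fin (2 * k + 1)) : ℕ) = 2 := by
    rw [Fin.coe_ofNat_eq_mod, Nat.mod_eq_of_lt (by omega)]
  have h02 : (0 : Fin (2 * k + 1)) ≠ 2 := fun h => by
    have h0 := congrArg Fin.val h
    rw [hval] at h0
    simp at h0
  have h12 : (1 : Fin (2 * k + 1)) ≠ 2 := fun h => by
    have h1 := congrArg Fin.val h
    rw [hval, Fin.val_one', Nat.mod_eq_of_lt (by omega)] at h1
    omega
  ext m
  rw [Finset.mem_filter, mem_weightedTuples le_rfl, Finset.mem_singleton]
  constructor
  · rintro ⟨⟨h0, -, hsum⟩, h2⟩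
    rw [← Finset.add_sum_erase _ _ (Finset.mem_univ 2), hval, h2, Nat.add_eq_left,
      Finset.sum_eq_zero_iff] at hsum
    funext j
    rcases eq_or_ne j 2 with rfl | hj
    · simp [h2]
    · rw [Pi.single_eq_of_ne hj]
      rcases Nat.mul_eq_zero.mp (hsum j (Finset.mem_erase.mpr ⟨hj, Finset.mem_univ j⟩)) with h | h
      · rw [Fin.ext (a := j) (b := 0) h, h0]
      · exact h
  · rintro rfl
    simp [h02, h12, Pi.single_apply, Nat.mod_eq_of_lt (show 2 < 2 * k + 1 by omega)]

/-- The measure on `ℕ` with mass `a n` at `n`. -/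
noncomputable def coeffMeasure (a : ℕ → ℝ) : Measure ℕ :=
  Measure.sum fun n => ENNReal.ofReal (a n) • Measure.dirac n

lemma integral_coeffMeasure {a : ℕ → ℝ} (ha : ∀ n, 0 ≤ a n) (g : ℕ → ℝ) :
    ∫ n, g n ∂coeffMeasure a = ∑' n, a n * g n := by
  rw [coeffMeasure, integral_sum_dirac fun _ => ENNReal.ofReal_ne_top]
  simp [ha]

lemma integrable_coeffMeasure_iff {a : ℕ → ℝ} (ha : ∀ n, 0 ≤ a n) (g : ℕ → ℝ) :
    Integrable g (coeffMeasure a) ↔ Summable fun n => a n * |g n| := by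
  rw [coeffMeasure, integrable_sum_dirac_iff fun _ => ENNReal.ofReal_ne_top]
  simp [ha]

lemma exp_mul_sub_natCast (u c : ℝ) (n : ℕ) :
    Real.exp (u * ((n : ℝ) - c)) = Real.exp (-(u * c)) * Real.exp u ^ n := by
  rw [← Real.exp_nat_mul, ← Real.exp_add]
  ring_nf

/-- The moment generating function of `n ↦ n - c` with respect to the coefficient measure. -/
noncomputable abbrev coeffMgf (a : ℕ → ℝ) (c : ℝ) : ℝ → ℝ :=
  mgf (fun n : ℕ => (n : ℝ) - c) (coeffMeasure a)

lemma coeffMgf_eq {a : ℕ → ℝ} (ha : ∀ n, 0 ≤ a n) (c u : ℝ) :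
    coeffMgf a c u = Real.exp (-(u * c)) * fsum a (Real.exp u) := by
  rw [coeffMgf, mgf, integral_coeffMeasure ha, fsum, ← tsum_mul_left]
  refine tsum_congr fun n => ?_
  rw [exp_mul_sub_natCast]
  ring

namespace IsK

variable {a : ℕ → ℝ} {R s : ℝ}

lemma mem_interior_integrableExpSet (hK : IsK a R) (hs : Real.exp s < R) (c : ℝ) :
    s ∈ interior (integrableExpSet (fun n : ℕ => (n : ℝ) - c) (coeffMeasure a)) := by
  have hopen : IsOpen {u : ℝ | Real.exp u < R} := isOpen_lt Real.continuous_exp continuous_const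
  refine mem_interior.mpr ⟨{u | Real.exp u < R}, fun u hu => ?_, hopen, hs⟩
  change Integrable (fun n : ℕ => Real.exp (u * ((n : ℝ) - c))) (coeffMeasure a)
  rw [integrable_coeffMeasure_iff hK.nonneg]
  refine ((hK.conv _ (Real.exp_pos u).le hu).mul_left (Real.exp (-(u * c)))).congr fun n => ?_
  rw [abs_of_pos (Real.exp_pos _), exp_mul_sub_natCast]
  ring

lemma analyticAt_coeffMgf (hK : IsK a R) (hs : Real.exp s < R) (c : ℝ) :
    AnalyticAt ℝ (coeffMgf a c) s :=
  analyticAt_mgf (hK.mem_interior_integrableExpSet hs c)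

lemma iteratedDeriv_coeffMgf (hK : IsK a R) (hs : Real.exp s < R) (c : ℝ) (j : ℕ) :
    iteratedDeriv j (coeffMgf a c) s =
      Real.exp (-(s * c)) * ∑' n : ℕ, a n * Real.exp s ^ n * ((n : ℝ) - c) ^ j := by
  rw [iteratedDeriv_mgf (hK.mem_interior_integrableExpSet hs c),
    integral_coeffMeasure hK.nonneg, ← tsum_mul_left]
  refine tsum_congr fun n => ?_
  rw [exp_mul_sub_natCast]
  ring

lemma summable_pow_mul (hK : IsK a R) (hs : Real.exp s < R) (j : ℕ) :
    Summable fun n : ℕ => (n : ℝ) ^ j * a n * Real.exp s ^ n := by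
  have h := integrable_pow_mul_exp_of_mem_interior_integrableExpSet
    (hK.mem_interior_integrableExpSet hs 0) j
  rw [integrable_coeffMeasure_iff hK.nonneg] at h
  refine h.congr fun n => ?_
  rw [abs_of_nonneg (by rw [sub_zero]; positivity), exp_mul_sub_natCast]
  simp only [sub_zero, mul_zero, neg_zero, Real.exp_zero, one_mul]
  ring

lemma fsum_pos_s3 (hK : IsK a R) (hs : Real.exp s < R) : 0 < fsum a (Real.exp s) :=
  (hK.conv _ (Real.exp_pos s).le hs).tsum_pos
    (fun n => mul_nonneg (hK.nonneg n) (by positivity)) 0 (by simpa using hK.pos₀)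

lemma analyticAt_fulcrum (hK : IsK a R) (hs : Real.exp s < R) :
    AnalyticAt ℝ (fulcrum a) s := by
  have h : fulcrum a = fun u => Real.log (coeffMgf a 0 u) := by
    funext u
    simp [fulcrum, coeffMgf_eq hK.nonneg]
  rw [h]
  refine (hK.analyticAt_coeffMgf hs 0).log ?_
  rw [coeffMgf_eq hK.nonneg]
  exact mul_pos (Real.exp_pos _) (hK.fsum_pos_s3 hs)

lemma tsum_mul_sub_mf (hK : IsK a R) (hs : Real.exp s < R) :
    ∑' n : ℕ, a n * Real.exp s ^ n * ((n : ℝ) - mf a (Real.exp s)) = 0 := by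
  have h0 := (hK.conv _ (Real.exp_pos s).le hs).hasSum
  have h1 := (hK.summable_pow_mul hs 1).hasSum
  simp only [pow_one] at h1
  have h := h1.sub (h0.mul_left (mf a (Real.exp s)))
  have hpos := (hK.fsum_pos_s3 hs).ne'
  have hzero : ∑' n : ℕ, (n : ℝ) * a n * Real.exp s ^ n -
      mf a (Real.exp s) * fsum a (Real.exp s) = 0 := by
    rw [mf, div_mul_cancel₀ _ hpos, sub_self]
  exact (tsum_congr fun n => by ring).trans (h.tsum_eq.trans hzero)

lemma hasSum_mul_sub_mf_sq (hK : IsK a R) (hs : Real.exp s < R) :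
    HasSum (fun n : ℕ => a n * Real.exp s ^ n * ((n : ℝ) - mf a (Real.exp s)) ^ 2)
      (fsum a (Real.exp s) * sigma2 a (Real.exp s)) := by
  have h0 := (hK.conv _ (Real.exp_pos s).le hs).hasSum
  have h1 := (hK.summable_pow_mul hs 1).hasSum
  have h2 := (hK.summable_pow_mul hs 2).hasSum
  simp only [pow_one] at h1
  have hpos := (hK.fsum_pos_s3 hs).ne'
  have hm : ∑' n : ℕ, (n : ℝ) * a n * Real.exp s ^ n =
      mf a (Real.exp s) * fsum a (Real.exp s) := by
    rw [mf, div_mul_cancel₀ _ hpos]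
  rw [← fsum] at h0
  rw [hm] at h1
  have h := (h2.sub (h1.mul_left (2 * mf a (Real.exp s)))).add
    (h0.mul_left (mf a (Real.exp s) ^ 2))
  convert! h using 1
  · funext n
    ring
  · rw [sigma2, mul_sub, mul_div_cancel₀ _ hpos]
    ring

lemma sigma2_pos (hK : IsK a R) (hs : Real.exp s < R) : 0 < sigma2 a (Real.exp s) := by
  have h := hK.hasSum_mul_sub_mf_sq hs
  have hnonneg : ∀ n : ℕ, 0 ≤ a n * Real.exp s ^ n * ((n : ℝ) - mf a (Real.exp s)) ^ 2 :=
    fun n => mul_nonneg (mul_nonneg (hK.nonneg n) (by positivity)) (sq_nonneg _)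
  have key : ∃ n : ℕ, 0 < a n ∧ (n : ℝ) - mf a (Real.exp s) ≠ 0 := by
    obtain ⟨n, hn, han⟩ := hK.nonconst
    by_cases hm : mf a (Real.exp s) = 0
    · exact ⟨n, han, by rw [hm, sub_zero]; positivity⟩
    · exact ⟨0, hK.pos₀, by simpa using hm⟩
  obtain ⟨n, han, hne⟩ := key
  have hpos := h.summable.tsum_pos hnonneg n
    (mul_pos (mul_pos han (by positivity)) (by positivity))
  rw [h.tsum_eq] at hpos
  exact pos_of_mul_pos_right hpos (hK.fsum_pos_s3 hs).le

lemma normMoment_eq_iteratedDeriv (hK : IsK a R) (hs : Real.exp s < R) (j : ℕ) :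
    normMoment a (Real.exp s) j =
      (Real.exp (s * mf a (Real.exp s)) / fsum a (Real.exp s)) *
        iteratedDeriv j (coeffMgf a (mf a (Real.exp s))) s / sigma a (Real.exp s) ^ j := by
  rw [hK.iteratedDeriv_coeffMgf hs, normMoment, div_mul_eq_mul_div, ← mul_assoc, ← Real.exp_add,
    add_neg_cancel, Real.exp_zero, one_mul, ← tsum_div_const, ← tsum_div_const]
  refine tsum_congr fun n => ?_
  rw [div_pow]
  ring

lemma coeffMgf_eventuallyEq_exp (hK : IsK a R) (hs : Real.exp s < R) (c : ℝ) :
    coeffMgf a c =ᶠ[𝓝 s] fun u => Real.exp (fulcrum a u - u * c) := by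
  have hopen : IsOpen {u : ℝ | Real.exp u < R} := isOpen_lt Real.continuous_exp continuous_const
  filter_upwards [hopen.mem_nhds hs] with u hu
  rw [coeffMgf_eq hK.nonneg, sub_eq_add_neg, Real.exp_add, fulcrum,
    Real.exp_log (hK.fsum_pos_s3 hu), mul_comm]

lemma iteratedDeriv_fulcrum_sub (hK : IsK a R) (hs : Real.exp s < R) (c : ℝ) {j : ℕ}
    (hj : 2 ≤ j) :
    iteratedDeriv j (fun u => fulcrum a u - u * c) s = iteratedDeriv j (fulcrum a) s := by
  have hlin : AnalyticAt ℝ (fun u : ℝ => u * c) s := by fun_prop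
  have h := iteratedDeriv_sub (n := j) (hK.analyticAt_fulcrum hs).contDiffAt hlin.contDiffAt
  have hzero : iteratedDeriv j (fun u : ℝ => u * c) s = 0 := by
    obtain ⟨i, rfl⟩ := Nat.exists_eq_add_of_le' hj
    rw [iteratedDeriv_succ', iteratedDeriv_succ']
    simp
  rw [hzero, sub_zero] at h
  exact h

lemma normMoment_zero (hK : IsK a R) (hs : Real.exp s < R) :
    normMoment a (Real.exp s) 0 = 1 := by
  simp only [normMoment, pow_zero, mul_one]
  rw [tsum_div_const, ← fsum, div_self (hK.fsum_pos_s3 hs).ne']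

lemma normMoment_two (hK : IsK a R) (hs : Real.exp s < R) :
    normMoment a (Real.exp s) 2 = 1 := by
  rw [hK.normMoment_eq_iteratedDeriv hs, hK.iteratedDeriv_coeffMgf hs,
    (hK.hasSum_mul_sub_mf_sq hs).tsum_eq, sigma, Real.sq_sqrt (hK.sigma2_pos hs).le, Real.exp_neg]
  have h1 := (hK.fsum_pos_s3 hs).ne'
  have h2 := (hK.sigma2_pos hs).ne'
  have h3 := Real.exp_ne_zero (s * mf a (Real.exp s))
  field_simp

lemma sigma_pos (hK : IsK a R) (hs : Real.exp s < R) : 0 < sigma a (Real.exp s) :=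
  Real.sqrt_pos.mpr (hK.sigma2_pos hs)

lemma nat_mul_normMoment (hK : IsK a R) (hs : Real.exp s < R) (n : ℕ) :
    n * (normMoment a (Real.exp s) n / n.factorial) =
      ∑ j ∈ Finset.range (n + 1),
        j * (iteratedDeriv j (fun u => fulcrum a u - u * mf a (Real.exp s)) s /
          (sigma a (Real.exp s) ^ j * j.factorial)) *
        (normMoment a (Real.exp s) (n - j) / (n - j).factorial) := by
  simp only [hK.normMoment_eq_iteratedDeriv hs, div_div]
  exact nat_mul_scaled_iteratedDeriv (hK.analyticAt_coeffMgf hs _)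
    ((hK.analyticAt_fulcrum hs).sub (by fun_prop)) (hK.coeffMgf_eventuallyEq_exp hs _)
    (hK.sigma_pos hs).ne' _ n

lemma normMoment_one (hK : IsK a R) (hs : Real.exp s < R) :
    normMoment a (Real.exp s) 1 = 0 := by
  rw [hK.normMoment_eq_iteratedDeriv hs, hK.iteratedDeriv_coeffMgf hs]
  simp only [pow_one]
  rw [hK.tsum_mul_sub_mf hs]
  simp

lemma iteratedDeriv_one_fulcrum_sub (hK : IsK a R) (hs : Real.exp s < R) :
    iteratedDeriv 1 (fun u => fulcrum a u - u * mf a (Real.exp s)) s = 0 := by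
  have h := hK.nat_mul_normMoment hs 1
  simpa [Finset.sum_range_succ, hK.normMoment_one hs, hK.normMoment_zero hs,
    (hK.sigma_pos hs).ne'] using h.symm

lemma iteratedDeriv_two_fulcrum_s3 (hK : IsK a R) (hs : Real.exp s < R) :
    iteratedDeriv 2 (fulcrum a) s = sigma a (Real.exp s) ^ 2 := by
  have h := hK.nat_mul_normMoment hs 2
  simp only [Finset.sum_range_succ, Finset.range_zero, Finset.sum_empty,
    hK.iteratedDeriv_one_fulcrum_sub hs, hK.iteratedDeriv_fulcrum_sub hs _ le_rfl,
    hK.normMoment_two hs, hK.normMoment_zero hs] at h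
  have hne := (hK.sigma_pos hs).ne'
  simp [Nat.factorial] at h
  field_simp at h
  exact h.symm

lemma iteratedDeriv_two_fulcrum_rpow (hK : IsK a R) (hs : Real.exp s < R) (j : ℕ) :
    iteratedDeriv 2 (fulcrum a) s ^ ((j : ℝ) / 2) = sigma a (Real.exp s) ^ j := by
  rw [hK.iteratedDeriv_two_fulcrum_s3 hs, ← Real.rpow_natCast, ← Real.rpow_natCast,
    ← Real.rpow_mul (hK.sigma_pos hs).le]
  congr 1
  push_cast
  ring

/-- The moments of the normalized family in terms of the derivatives of the fulcrum. -/
lemma normMoment_eq_sum (hK : IsK a R) (hs : Real.exp s < R) (n : ℕ) :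
    normMoment a (Real.exp s) n = ∑ m ∈ weightedTuples n n,
      ((n.factorial : ℝ) / ∏ j : Fin (n + 1), ((m j).factorial : ℝ)) *
        ∏ j : Fin (n + 1), (iteratedDeriv j (fulcrum a) s /
          (iteratedDeriv 2 (fulcrum a) s ^ (((j : ℕ) : ℝ) / 2) * (j : ℕ).factorial)) ^ m j := by
  have h := eq_tupleSum_of_recurrence _ (fun n => normMoment a (Real.exp s) n / n.factorial)
    (by simp [hK.iteratedDeriv_one_fulcrum_sub hs]) (by simp [hK.normMoment_zero hs])
    (hK.nat_mul_normMoment hs) (le_refl n)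
  rw [div_eq_iff (by positivity), mul_comm] at h
  rw [h, tupleSum, Finset.mul_sum]
  refine Finset.sum_congr rfl fun m hm => ?_
  rw [mem_weightedTuples le_rfl] at hm
  rw [Finset.prod_div_distrib, div_mul_eq_mul_div, mul_div_assoc]
  congr 2
  refine Finset.prod_congr rfl fun j _ => ?_
  rw [hK.iteratedDeriv_two_fulcrum_rpow hs]
  rcases Nat.lt_or_ge (j : ℕ) 2 with hj | hj
  · have hmj : m j = 0 := by
      have hlt := j.isLt
      interval_cases hval : (j : ℕ)
      · rw [Fin.ext (a := j) (b := 0) hval, hm.1]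
      · rw [Fin.ext (a := j) (b := 1) (by rw [hval, Fin.val_one', Nat.mod_eq_of_lt hlt]), hm.2.1]
    simp [hmj]
  · rw [hK.iteratedDeriv_fulcrum_sub hs _ hj]

end IsK

/-- for even `n = 2k`, `k ≥ 2`, the deviation of `E(X̆_t^n)` from the normal
moment `(2k)!/(k! 2^k)` as a sum over tuples with `m₂ ≠ k`. -/
theorem statement3 (a : ℕ → ℝ) (R : ℝ) (hK : IsK a R) (s : ℝ) (hs : Real.exp s < R)
    (k : ℕ) (hk : 2 ≤ k) :
    normMoment a (Real.exp s) (2 * k) -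
        (Nat.factorial (2 * k) : ℝ) / ((Nat.factorial k : ℝ) * 2 ^ k) =
      ∑ m ∈ (tuples (2 * k)).filter (fun m => m 2 ≠ k),
        ((Nat.factorial (2 * k) : ℝ) / ∏ j : Fin (2 * k + 1), (Nat.factorial (m j) : ℝ)) *
          ∏ j : Fin (2 * k + 1),
            (iteratedDeriv (j : ℕ) (fulcrum a) s /
              ((iteratedDeriv 2 (fulcrum a) s) ^ (((j : ℕ) : ℝ) / 2) *
                (Nat.factorial (j : ℕ) : ℝ))) ^ (m j) := by
  have hval : ((2 : Fin (2 * k + 1)) : ℕ) = 2 := by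
    rw [Fin.coe_ofNat_eq_mod, Nat.mod_eq_of_lt (by omega)]
  rw [hK.normMoment_eq_sum hs, ← Finset.sum_filter_add_sum_filter_not _ (fun m => m 2 = k),
    filter_weightedTuples_eq_singleton (by omega), Finset.sum_singleton, weightedTuples_self,
    add_sub_right_comm, add_eq_right, sub_eq_zero]
  have h1 : ∏ j : Fin (2 * k + 1), (((Pi.single 2 k : Fin (2 * k + 1) → ℕ) j).factorial : ℝ) =
      k.factorial := by
    rw [Finset.prod_eq_single 2 (fun j _ hj => by simp [hj]) (by simp), Pi.single_eq_same]
  rw [h1, Finset.prod_eq_single 2 (fun j _ hj => by simp [hj]) (by simp), Pi.single_eq_same,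
    hK.iteratedDeriv_two_fulcrum_rpow hs, hval, hK.iteratedDeriv_two_fulcrum_s3 hs]
  have hne := (hK.sigma_pos hs).ne'
  rw [← div_div, div_self (pow_ne_zero 2 hne), Nat.factorial_two, Nat.cast_ofNat, one_div,
    inv_pow, ← div_eq_mul_inv, div_div]

end KhinchinPaper
end
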